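/- Let A be an ℕ-graded commutative ring generated over A_0 by degree-1 elements, and let M be a ℤ-graded A-module. Suppose k ∈ ℤ and let M_{≥k} denote the graded submodule ⨁_{n≥k} M_n and M_{<k} the quotient M/M_{≥k}. Then for every homogeneous a of degree 1, the induced sequence M_{≥k}[a⁻¹]_0 → M[a⁻¹]_0 → M_{<k}[a⁻¹]_0 identifies M_{≥k}[a⁻¹]_0 ≅ M[a⁻¹]_0, i.e., the localization map on degree-0 parts induced by the inclusion M_{≥k} ⊆ M is an isomorphism. -/

import Mathlib

section

variable {A : Type*} [CommRing A]

/-- The submodule `M_{≥k} = ⨁_{n ≥ k} M_n` of a ℤ-graded module. -/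
def truncGE {M : Type*} [AddCommGroup M] [Module A M]
    (ℳ : ℤ → AddSubgroup M) (k : ℤ) : Submodule A M :=
  Submodule.span A {y : M | ∃ n : ℤ, k ≤ n ∧ y ∈ ℳ n}

/-- The degree-zero part of the graded localization `N[a⁻¹]` (with `a` of degree 1), for a
module `N` whose grading is described via a degree function into an ambient graded module. -/
def locDegZero {N : Type*} [AddCommGroup N] [Module A N]
    (grade : ℤ → N → Prop) (a : A) :
    Submodule ℤ (LocalizedModule (Submonoid.powers a) N) :=
  Submodule.span ℤ
    {y | ∃ (n : ℕ) (m : N), grade (n : ℤ) m ∧ (a ^ n : A) • y = LocalizedModule.mk m 1}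

end

/-- let `A` be an ℕ-graded commutative ring generated over `A₀` by degree-one
elements and `M` a ℤ-graded `A`-module; for `k ∈ ℤ` and `a` homogeneous of degree 1, the map
`M_{≥k}[a⁻¹]₀ → M[a⁻¹]₀` on degree-zero parts induced by the inclusion `M_{≥k} ⊆ M` is an
isomorphism (a bijection between the two degree-zero parts). -/
theorem stmt17 {A : Type*} [CommRing A] (𝒜 : ℤ → Submodule ℤ A) [GradedAlgebra 𝒜]
    (hA : ∀ n : ℤ, n < 0 → 𝒜 n = ⊥)
    (hgen : Subring.closure ((𝒜 0 : Set A) ∪ (𝒜 1 : Set A)) = ⊤)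
    {M : Type*} [AddCommGroup M] [Module A M]
    (ℳ : ℤ → AddSubgroup M) [DirectSum.Decomposition ℳ]
    (hℳ : ∀ (i j : ℤ), ∀ c ∈ 𝒜 i, ∀ m ∈ ℳ j, c • m ∈ ℳ (i + j))
    (k : ℤ) (a : A) (ha : a ∈ 𝒜 1) :
    Set.BijOn
      (IsLocalizedModule.map (Submonoid.powers a)
        (LocalizedModule.mkLinearMap (Submonoid.powers a) (truncGE ℳ k))
        (LocalizedModule.mkLinearMap (Submonoid.powers a) M)
        (truncGE ℳ k).subtype)
      (SetLike.coe (locDegZero (fun n (m : truncGE ℳ k) => (m : M) ∈ ℳ n) a))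
      (SetLike.coe (locDegZero (fun n (m : M) => m ∈ ℳ n) a)) := by
  set f := (IsLocalizedModule.map (Submonoid.powers a)
        (LocalizedModule.mkLinearMap (Submonoid.powers a) (truncGE ℳ k))
        (LocalizedModule.mkLinearMap (Submonoid.powers a) M)
        (truncGE ℳ k).subtype) with hf
  have hmk : ∀ m : truncGE (A := A) ℳ k,
      f (LocalizedModule.mk m 1) = LocalizedModule.mk (m : M) 1 := fun m =>
    IsLocalizedModule.map_apply (Submonoid.powers a)
      (LocalizedModule.mkLinearMap (Submonoid.powers a) (truncGE ℳ k))
      (LocalizedModule.mkLinearMap (Submonoid.powers a) M) (truncGE ℳ k).subtype m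
  have hinj : Function.Injective f :=
    IsLocalizedModule.map_injective (Submonoid.powers a) _ _ _ (Submodule.subtype_injective _)
  have hpow : ∀ (N : ℕ) (j : ℤ) (m : M), m ∈ ℳ j → a ^ N • m ∈ ℳ (N + j) := by
    intro N j m hm
    refine hℳ _ _ _ ?_ _ hm
    simpa using SetLike.pow_mem_graded N ha
  refine ⟨?_, hinj.injOn, ?_⟩
  · intro y hy
    have hle : locDegZero (fun n (m : truncGE (A := A) ℳ k) => (m : M) ∈ ℳ n) a ≤
        (locDegZero (fun n (m : M) => m ∈ ℳ n) a).comap f.toAddMonoidHom.toIntLinearMap := by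
      refine Submodule.span_le.2 ?_
      rintro y ⟨n, m, hm, hy⟩
      refine Submodule.subset_span ⟨n, (m : M), hm, ?_⟩
      change a ^ n • f y = _
      rw [← hmk, ← hy, map_smul]
    exact hle hy
  · intro y hy
    have hle : locDegZero (fun n (m : M) => m ∈ ℳ n) a ≤
        (locDegZero (fun n (m : truncGE (A := A) ℳ k) => (m : M) ∈ ℳ n) a).map
          f.toAddMonoidHom.toIntLinearMap := by
      refine Submodule.span_le.2 ?_
      rintro y ⟨n, m, hm, hy⟩
      have hm2 := hpow k.toNat n m hm
      have hmem : a ^ k.toNat • m ∈ truncGE (A := A) ℳ k :=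
        Submodule.subset_span ⟨_, by omega, hm2⟩
      let s : Submonoid.powers a := ⟨a ^ (k.toNat + n), _, rfl⟩
      have hx : a ^ (k.toNat + n) • (LocalizedModule.mk ⟨_, hmem⟩ s :
          LocalizedModule (Submonoid.powers a) (truncGE (A := A) ℳ k)) =
          LocalizedModule.mk ⟨_, hmem⟩ 1 := by
        rw [LocalizedModule.smul'_mk]
        exact LocalizedModule.mk_cancel s _
      refine ⟨LocalizedModule.mk ⟨_, hmem⟩ s, Submodule.subset_span
        ⟨k.toNat + n, ⟨_, hmem⟩, ?_, hx⟩, ?_⟩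
      · push_cast
        exact hm2
      · change f _ = y
        refine IsLocalizedModule.smul_injective
          (LocalizedModule.mkLinearMap (Submonoid.powers a) M) s ?_
        change a ^ (k.toNat + n) • f _ = a ^ (k.toNat + n) • y
        rw [← map_smul, hx, hmk, pow_add, mul_smul, hy, LocalizedModule.smul'_mk]
    obtain ⟨x, hx, rfl⟩ := hle hy
    exact ⟨x, hx, rfl⟩
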